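/- arXiv:math/0410308 — 2 statements merged into one kernel-verified Lean document; each statement's English description precedes it below -/
import Mathlib

section
/- (Alon's theorem) Let X_1, …, X_n be pairwise disjoint sets, let r_1, …, r_n and s_1, …, s_n be positive integers, and for 1 ≤ j ≤ h let A_j and B_j be subsets of the union X = X_1 ∪ ⋯ ∪ X_n satisfying: (1) |A_j ∩ X_i| ≤ r_i and |B_j ∩ X_i| ≤ s_i for all 1 ≤ i ≤ n and 1 ≤ j ≤ h; (2) A_j ∩ B_j = ∅ for all 1 ≤ j ≤ h; (3) A_i ∩ B_j ≠ ∅ for all 1 ≤ i < j ≤ h. Then h ≤ ∏_{i=1}^n C(r_i + s_i, r_i), where C(·,·) denotes the binomial coefficient. -/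
open Finset in
/-- If a square matrix with nonzero diagonal vanishes above the diagonal, then any family of
vectors whose span contains all its columns has at least as many members as there are columns. -/
theorem le_card_of_triangular_of_col_mem_span {K ι : Type*} [Field K] [Fintype ι] {h : ℕ}
    (M : Matrix (Fin h) (Fin h) K) (hdiag : ∀ i, M i i ≠ 0) (hzero : ∀ i j, i < j → M i j = 0)
    (v : ι → Fin h → K) (hspan : ∀ j, M.col j ∈ Submodule.span K (Set.range v)) :
    h ≤ Fintype.card ι := by
  have hdet : M.det ≠ 0 := by
    rw [Matrix.det_of_isLowerTriangular M fun i j hij => hzero i j hij]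
    exact prod_ne_zero_iff.2 fun i _ => hdiag i
  have hcols := Matrix.linearIndependent_cols_of_det_ne_zero hdet
  calc h = Module.finrank K (Submodule.span K (Set.range M.col)) := by
        rw [finrank_span_eq_card hcols, Fintype.card_fin]
    _ ≤ Module.finrank K (Submodule.span K (Set.range v)) :=
        Submodule.finrank_mono (Submodule.span_le.2 (Set.range_subset_iff.2 hspan))
    _ ≤ Fintype.card ι := finrank_range_le_card v

open Finset in
/-- A product of linear forms, `s i` of them in the `i`-th block of variables, lies in the span
of the monomials of degree `s i` in the `i`-th block, for every `i`. -/
theorem prod_linear_forms_mem_span_monomials {K J ι : Type*} [Field K] [Fintype ι] [DecidableEq ι]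
    {κ : ι → Type*} [∀ i, Fintype (κ i)] (s : ι → ℕ)
    (c : ∀ i, J → κ i → K) (w : ∀ i, Fin (s i) → κ i → K) :
    (fun j => ∏ i, ∏ t, ∑ k, c i j k * w i t k) ∈
      Submodule.span K (Set.range fun (m : ∀ i, Sym (κ i) (s i)) j =>
        ∏ i, ((m i : Multiset (κ i)).map (c i j)).prod) := by
  have hexpand : (fun j => ∏ i, ∏ t, ∑ k, c i j k * w i t k) =
      ∑ f : ∀ i, Fin (s i) → κ i, (∏ i, ∏ t, w i t (f i t)) •
        fun j => ∏ i, ∏ t, c i j (f i t) := by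
    ext j
    simp only [prod_univ_sum, Fintype.piFinset_univ, Finset.sum_apply, Pi.smul_apply, smul_eq_mul,
      ← prod_mul_distrib, mul_comm]
  rw [hexpand]
  refine Submodule.sum_mem _ fun f _ => Submodule.smul_mem _ _ (Submodule.subset_span ?_)
  refine ⟨fun i => ⟨univ.val.map (f i), by simp⟩, ?_⟩
  ext j
  simp [List.prod_ofFn]

/-- A finite set with at most `s` elements can be enumerated by `Fin s`, using an extra
element `z` as padding. -/
theorem Finset.exists_fin_enumeration_with_padding {β : Type*} (S : Finset β) (z : β) {s : ℕ}
    (hS : S.card ≤ s) :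
    ∃ g : Fin s → β, (∀ b ∈ S, ∃ t, g t = b) ∧ ∀ t, g t = z ∨ g t ∈ S := by
  refine ⟨fun t => S.toList.getD t z, fun b hb => ?_, fun t => ?_⟩
  · obtain ⟨k, hk, rfl⟩ := List.getElem_of_mem (Finset.mem_toList.2 hb)
    exact ⟨⟨k, by simpa using lt_of_lt_of_le hk (by simpa using hS)⟩, List.getD_eq_getElem _ _ hk⟩
  · by_cases ht : (t : ℕ) < S.toList.length
    · right
      simpa only [List.getD_eq_getElem _ _ ht] using Finset.mem_toList.1 (List.getElem_mem ht)
    · left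
      exact List.getD_eq_default _ _ (not_lt.1 ht)

/-- Every type embeds into the nonzero elements of some field. -/
theorem exists_field_embedding_ne_zero.{u} (α : Type u) :
    ∃ (K : Type u) (_ : Field K) (e : α → K), Function.Injective e ∧ ∀ a, e a ≠ 0 := by
  refine ⟨FractionRing (MvPolynomial α ℚ), inferInstance,
    fun a => algebraMap (MvPolynomial α ℚ) _ (MvPolynomial.X a), ?_, fun a => ?_⟩
  · exact (IsFractionRing.injective _ _).comp (MvPolynomial.X_injective)
  · exact (map_ne_zero_iff _ (IsFractionRing.injective _ _)).2 (MvPolynomial.X_ne_zero a)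

set_option linter.unusedVariables false in
open Finset Polynomial in
/-- Alon's theorem: with `X 1, …, X n` pairwise disjoint sets and
finite sets `A j`, `B j ⊆ ⋃ i, X i` with `|A j ∩ X i| ≤ r i`, `|B j ∩ X i| ≤ s i`,
`A j ∩ B j = ∅`, and `A i ∩ B j ≠ ∅` for `i < j`, we have
`h ≤ ∏ i, (r i + s i).choose (r i)`. -/
theorem alon_skew_bollobas {α : Type*} (n h : ℕ) (X : Fin n → Set α)
    (hdisj : Pairwise fun i j => Disjoint (X i) (X j))
    (r s : Fin n → ℕ) (hr : ∀ i, 0 < r i) (hs : ∀ i, 0 < s i)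
    (A B : Fin h → Set α)
    (hAsub : ∀ j, A j ⊆ ⋃ i, X i) (hBsub : ∀ j, B j ⊆ ⋃ i, X i)
    (hAfin : ∀ j i, (A j ∩ X i).Finite) (hBfin : ∀ j i, (B j ∩ X i).Finite)
    (hAcard : ∀ j i, (A j ∩ X i).ncard ≤ r i)
    (hBcard : ∀ j i, (B j ∩ X i).ncard ≤ s i)
    (hAB : ∀ j, A j ∩ B j = ∅)
    (hcross : ∀ i j : Fin h, i < j → (A i ∩ B j).Nonempty) :
    h ≤ ∏ i, (r i + s i).choose (r i) := by
  classical
  obtain ⟨K, _, e, he, he0⟩ := exists_field_embedding_ne_zero α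
  have henum : ∀ j i, ∃ g : Fin (s i) → K,
      (∀ b ∈ (hBfin j i).toFinset.image e, ∃ t, g t = b) ∧
        ∀ t, g t = 0 ∨ g t ∈ (hBfin j i).toFinset.image e := fun j i =>
    Finset.exists_fin_enumeration_with_padding _ 0 <| card_image_le.trans <| by
      rw [← Set.ncard_eq_toFinset_card _ (hBfin j i)]; exact hBcard j i
  choose g hgsurj hgmem using henum
  let P : Fin h → Fin n → K[X] := fun j i =>
    ∏ a ∈ (hAfin j i).toFinset, (Polynomial.X - C (e a))
  have hdeg : ∀ j i, (P j i).natDegree < r i + 1 := fun j i => by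
    rw [natDegree_finsetProd_X_sub_C_eq_card, ← Set.ncard_eq_toFinset_card _ (hAfin j i)]
    exact Nat.lt_succ_of_le (hAcard j i)
  have hroot : ∀ j i x, (P j i).eval x = 0 ↔ ∃ a ∈ A j ∩ X i, x = e a := fun j i x => by
    simp [P, eval_prod, prod_eq_zero_iff, sub_eq_zero]
  have hcard : Fintype.card (∀ i, Sym (Fin (r i + 1)) (s i)) =
      ∏ i, (r i + s i).choose (r i) := by
    rw [Fintype.card_pi]
    refine prod_congr rfl fun i _ => ?_
    rw [Sym.card_sym_eq_multichoose, Nat.multichoose_eq, Fintype.card_fin,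
      Nat.add_right_comm, Nat.add_sub_cancel, Nat.choose_symm_add]
  rw [← hcard]
  refine le_card_of_triangular_of_col_mem_span
    (Matrix.of fun j k => ∏ i, ∏ t, (P j i).eval (g k i t)) (fun j => ?_) (fun j k hjk => ?_)
    (fun m j => ∏ i, ((m i : Multiset _).map fun d : Fin (r i + 1) => (P j i).coeff d).prod)
    fun k => ?_
  · rw [Matrix.of_apply]
    refine prod_ne_zero_iff.2 fun i _ => prod_ne_zero_iff.2 fun t _ => ?_
    rw [Ne, hroot]
    rintro ⟨a, ⟨haA, -⟩, ha⟩
    rcases hgmem j i t with h0 | hmem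
    · exact he0 a (ha ▸ h0)
    · obtain ⟨b, hb, hbe⟩ := mem_image.1 hmem
      obtain rfl := he (hbe.trans ha)
      have hmemAB : b ∈ A j ∩ B j := ⟨haA, ((hBfin j i).mem_toFinset.1 hb).1⟩
      simp [hAB j] at hmemAB
  · obtain ⟨a, haA, haB⟩ := hcross j k hjk
    obtain ⟨i, hi⟩ := Set.mem_iUnion.1 (hAsub j haA)
    obtain ⟨t, ht⟩ := hgsurj k i (e a)
      (mem_image_of_mem e ((hBfin k i).mem_toFinset.2 ⟨haB, hi⟩))
    exact prod_eq_zero (mem_univ i) <| prod_eq_zero (mem_univ t) <|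
      (hroot j i _).2 ⟨a, ⟨haA, hi⟩, ht⟩
  · have hcol : (Matrix.of fun j k => ∏ i, ∏ t, (P j i).eval (g k i t)).col k =
        fun j => ∏ i, ∏ t, ∑ d : Fin (r i + 1), (P j i).coeff d * g k i t ^ (d : ℕ) := by
      ext j
      rw [Matrix.col_apply, Matrix.of_apply]
      refine prod_congr rfl fun i _ => prod_congr rfl fun t _ => ?_
      rw [eval_eq_sum_range' (hdeg j i), Finset.sum_range]
    rw [hcol]
    exact prod_linear_forms_mem_span_monomials s
      (fun i j (d : Fin (r i + 1)) => (P j i).coeff d) fun i t d => g k i t ^ (d : ℕ)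
end

section
/- Let X_1, …, X_n be pairwise disjoint sets, and for 1 ≤ j ≤ h let A_j and B_j be subsets of the union X = X_1 ∪ ⋯ ∪ X_n satisfying: (1) |A_j ∩ X_i| ≤ 1 and |B_j ∩ X_i| ≤ 1 for all 1 ≤ i ≤ n and 1 ≤ j ≤ h; (2) A_j ∩ B_j = ∅ for all 1 ≤ j ≤ h; (3) A_i ∩ B_j ≠ ∅ for all 1 ≤ i < j ≤ h. Then h ≤ 2^n. -/
/-- A multipartite skew Bollobás inequality for functions: if `a j` and `b j` differ everywhere
while `a i` and `b j` agree somewhere for `i < j`, then there are at most `2 ^ n` pairs. -/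
theorem le_two_pow_of_skew_agree {β K : Type*} [Field K] (t : β → K)
    (ht : Function.Injective t) {n h : ℕ} (a b : Fin h → Fin n → β)
    (hne : ∀ j k, a j k ≠ b j k) (hagree : ∀ i j, i < j → ∃ k, a i k = b j k) :
    h ≤ 2 ^ n := by
  classical
  let P : Matrix (Fin h) (Finset (Fin n)) K := fun i S => ∏ k ∈ S, t (a i k)
  let Q : Matrix (Finset (Fin n)) (Fin h) K := fun S j => ∏ k ∈ Finset.univ \ S, -t (b j k)
  have entry (i j : Fin h) : (P * Q) i j = ∏ k, (t (a i k) - t (b j k)) := by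
    simp only [sub_eq_add_neg, Finset.prod_add, Finset.powerset_univ]
    exact Matrix.mul_apply
  have htri : (P * Q).IsLowerTriangular := by
    intro i j hij
    obtain ⟨k, hk⟩ := hagree i j (OrderDual.toDual_lt_toDual.mp hij)
    rw [entry]
    exact Finset.prod_eq_zero (Finset.mem_univ k) (by rw [hk, sub_self])
  have hdet : (P * Q).det ≠ 0 := by
    rw [Matrix.det_of_isLowerTriangular _ htri]
    refine Finset.prod_ne_zero_iff.mpr fun j _ => ?_
    rw [entry]
    exact Finset.prod_ne_zero_iff.mpr fun k _ => sub_ne_zero.mpr (ht.ne (hne j k))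
  have hrank : (P * Q).rank = h := by
    rw [Matrix.rank_of_isUnit _ ((Matrix.isUnit_iff_isUnit_det _).mpr hdet.isUnit),
      Fintype.card_fin]
  calc
    h = (P * Q).rank := hrank.symm
    _ ≤ P.rank := Matrix.rank_mul_le_left P Q
    _ ≤ Fintype.card (Finset (Fin n)) := P.rank_le_card_width
    _ = 2 ^ n := by rw [Fintype.card_finset, Fintype.card_fin]

open Classical in
/-- A chosen element of `s`, or the default value `d` if `s` is empty. -/
noncomputable def Set.pickOr {α β : Type*} (s : Set α) (d : β) : α ⊕ β :=
  if hs : s.Nonempty then Sum.inl hs.some else Sum.inr d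

theorem Set.Subsingleton.pickOr_eq {α β : Type*} {s : Set α} (hs : s.Subsingleton) (d : β)
    {x : α} (hx : x ∈ s) : s.pickOr d = Sum.inl x := by
  have hne : s.Nonempty := ⟨x, hx⟩
  rw [Set.pickOr, dif_pos hne, hs hne.some_mem hx]

theorem Set.pickOr_ne_pickOr {α β : Type*} {s t : Set α} (hst : Disjoint s t) {d e : β}
    (hde : d ≠ e) : s.pickOr d ≠ t.pickOr e := by
  unfold Set.pickOr
  split_ifs with hs ht
  · exact fun heq => hst.ne_of_mem hs.some_mem ht.some_mem (Sum.inl.inj heq)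
  · exact Sum.inl_ne_inr
  · exact Sum.inr_ne_inl
  · exact fun heq => hde (Sum.inr.inj heq)

/-- Alon's theorem, case `r i = s i = 1`: with `X 1, …, X n` pairwise
disjoint sets and sets `A j`, `B j ⊆ ⋃ i, X i` meeting each `X i` in at most one
element, with `A j ∩ B j = ∅` and `A i ∩ B j ≠ ∅` for `i < j`, we have `h ≤ 2 ^ n`. -/
theorem alon_skew_bollobas_one {α : Type*} (n h : ℕ) (X : Fin n → Set α)
    (hdisj : Pairwise fun i j => Disjoint (X i) (X j))
    (A B : Fin h → Set α)
    (hAsub : ∀ j, A j ⊆ ⋃ i, X i) (hBsub : ∀ j, B j ⊆ ⋃ i, X i)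
    (hAcard : ∀ j i, (A j ∩ X i).Subsingleton)
    (hBcard : ∀ j i, (B j ∩ X i).Subsingleton)
    (hAB : ∀ j, A j ∩ B j = ∅)
    (hcross : ∀ i j : Fin h, i < j → (A i ∩ B j).Nonempty) :
    h ≤ 2 ^ n := by
  refine le_two_pow_of_skew_agree
    (fun x : α ⊕ Bool => algebraMap (MvPolynomial (α ⊕ Bool) ℚ)
      (FractionRing (MvPolynomial (α ⊕ Bool) ℚ)) (MvPolynomial.X x))
    ((IsFractionRing.injective _ _).comp MvPolynomial.X_injective)
    (fun j i => (A j ∩ X i).pickOr true) (fun j i => (B j ∩ X i).pickOr false) ?_ ?_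
  · intro j i
    exact Set.pickOr_ne_pickOr ((Set.disjoint_iff_inter_eq_empty.mpr (hAB j)).mono
      Set.inter_subset_left Set.inter_subset_left) (by decide)
  · intro i j hij
    obtain ⟨x, hxA, hxB⟩ := hcross i j hij
    obtain ⟨k, hk⟩ := Set.mem_iUnion.mp (hAsub i hxA)
    exact ⟨k, ((hAcard i k).pickOr_eq true ⟨hxA, hk⟩).trans
      ((hBcard j k).pickOr_eq false ⟨hxB, hk⟩).symm⟩
end
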